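/- arXiv:math/0402267 — 2 statements merged into one kernel-verified Lean document; each statement's English description precedes it below -/
import Mathlib

section
/- For every natural number n ≥ 1, the n-th symmetric product Sym^n(ℂ∖{0}) of the punctured complex plane is homeomorphic to ℂ^{n−1} × (ℂ∖{0}). (Under the identification of unordered n-tuples of nonzero complex numbers with monic degree-n polynomials ∏(X − z_i), this space is the complement of the coordinate hyperplane {constant coefficient = 0} in the space ℂ^n of coefficients.) -/
/-- The setoid on `Fin n → X` identifying tuples that differ by a permutation
of the coordinates (the permutation action of the symmetric group `Σ_n`). -/
def permSetoid (n : ℕ) (X : Type*) : Setoid (Fin n → X) where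
  r f g := ∃ σ : Equiv.Perm (Fin n), f ∘ σ = g
  iseqv := by
    refine ⟨fun f => ⟨Equiv.refl _, rfl⟩, ?_, ?_⟩
    · rintro f g ⟨σ, rfl⟩
      exact ⟨σ.symm, by ext i; simp⟩
    · rintro f g h ⟨σ, rfl⟩ ⟨τ, rfl⟩
      exact ⟨τ.trans σ, rfl⟩

/-- The `n`-th symmetric product of `X`: the quotient of `X^n` by the
permutation action of the symmetric group `Σ_n`, with the quotient topology. -/
def SymProd (n : ℕ) (X : Type*) : Type _ := Quotient (permSetoid n X)

instance (n : ℕ) (X : Type*) [TopologicalSpace X] : TopologicalSpace (SymProd n X) :=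
  inferInstanceAs (TopologicalSpace (Quotient (permSetoid n X)))

/-- The class of a tuple in the symmetric product. -/
def SymProd.mk {n : ℕ} {X : Type*} (f : Fin n → X) : SymProd n X :=
  Quotient.mk (permSetoid n X) f

open Polynomial in
/-- The vector of non-leading coefficients of the monic polynomial `∏ i, (X - z i)`. -/
noncomputable def monicCoeffs {n : ℕ} (z : Fin n → ℂ) : Fin n → ℂ :=
  fun k => (∏ i, (X - C (z i))).coeff k

section MonicCoeffs

open Polynomial

theorem exists_perm_comp_eq_of_map_univ_eq {ι α : Type*} [Fintype ι] {f g : ι → α}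
    (h : Finset.univ.val.map f = Finset.univ.val.map g) :
    ∃ σ : Equiv.Perm ι, f ∘ σ = g := by
  classical
  have e : ∀ a, Nonempty ({i // g i = a} ≃ {i // f i = a}) := fun a => by
    refine ⟨Fintype.equivOfCardEq ?_⟩
    have := congrArg (Multiset.count a) h
    rw [Multiset.count_map, Multiset.count_map] at this
    rw [Fintype.card_subtype, Fintype.card_subtype, Finset.card_def, Finset.card_def,
      Finset.filter_val, Finset.filter_val]
    simpa only [eq_comm] using this.symm
  let σ : Equiv.Perm ι := (Equiv.sigmaFiberEquiv g).symm.trans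
    ((Equiv.sigmaCongrRight fun a => (e a).some).trans (Equiv.sigmaFiberEquiv f))
  exact ⟨σ, funext fun i => ((e (g i)).some ⟨i, rfl⟩).2⟩

theorem continuous_coeff_prod_X_sub_C {ι : Type*} (s : Finset ι) (k : ℕ) :
    Continuous fun z : ι → ℂ => (∏ i ∈ s, (X - C (z i))).coeff k := by
  classical
  induction s using Finset.induction_on generalizing k with
  | empty => simpa using continuous_const
  | insert a s ha ih =>
    simp only [Finset.prod_insert ha, coeff_mul]
    refine continuous_finsetSum _ fun p _ => Continuous.mul ?_ (ih p.2)
    simp only [coeff_sub, coeff_C]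
    split_ifs <;> fun_prop

theorem continuous_monicCoeffs (n : ℕ) :
    Continuous (monicCoeffs : (Fin n → ℂ) → Fin n → ℂ) :=
  continuous_pi fun k => continuous_coeff_prod_X_sub_C Finset.univ k

theorem monicCoeffs_comp_perm {n : ℕ} (z : Fin n → ℂ) (σ : Equiv.Perm (Fin n)) :
    monicCoeffs (z ∘ σ) = monicCoeffs z := by
  ext k
  simp only [monicCoeffs, Function.comp_apply]
  rw [Equiv.prod_comp σ fun i => X - C (z i)]

theorem prod_X_sub_C_eq_of_monicCoeffs_eq {n : ℕ} {z : Fin n → ℂ} {p : ℂ[X]} (hp : p.Monic)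
    (hn : p.natDegree = n) (h : ∀ k : Fin n, monicCoeffs z k = p.coeff k) :
    ∏ i, (X - C (z i)) = p := by
  have hz : (∏ i, (X - C (z i))).Monic := monic_prod_X_sub_C _ _
  have hzn : (∏ i, (X - C (z i))).natDegree = n := by simp
  ext k
  rcases lt_trichotomy k n with hk | rfl | hk
  · exact h ⟨k, hk⟩
  · have hz1 := hz.coeff_natDegree
    have hp1 := hp.coeff_natDegree
    rw [hzn] at hz1
    rw [hn] at hp1
    rw [hz1, hp1]
  · rw [coeff_eq_zero_of_natDegree_lt (hzn.trans_lt hk),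
      coeff_eq_zero_of_natDegree_lt (hn.trans_lt hk)]

theorem roots_prod_univ_X_sub_C {n : ℕ} (z : Fin n → ℂ) :
    (∏ i, (X - C (z i))).roots = Finset.univ.val.map z := by
  rw [← roots_multiset_prod_X_sub_C (Finset.univ.val.map z), Multiset.map_map]
  rfl

theorem monicCoeffs_eq_iff {n : ℕ} {z w : Fin n → ℂ} :
    monicCoeffs z = monicCoeffs w ↔ ∃ σ : Equiv.Perm (Fin n), z ∘ σ = w := by
  constructor
  · intro h
    apply exists_perm_comp_eq_of_map_univ_eq
    rw [← roots_prod_univ_X_sub_C, ← roots_prod_univ_X_sub_C,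
      prod_X_sub_C_eq_of_monicCoeffs_eq (monic_prod_X_sub_C w _) (by simp) (congrFun h)]
  · rintro ⟨σ, rfl⟩
    exact (monicCoeffs_comp_perm z σ).symm

theorem monicCoeffs_surjective (n : ℕ) :
    Function.Surjective (monicCoeffs : (Fin n → ℂ) → Fin n → ℂ) := by
  intro a
  have hdeg : (ofFn n a).degree < n := ofFn_degree_lt a
  have hp : (X ^ n + ofFn n a).Monic := monic_X_pow_add hdeg
  have hn : (X ^ n + ofFn n a).natDegree = n := natDegree_eq_of_degree_eq_some <| by
    rw [degree_add_eq_left_of_degree_lt (by simpa using hdeg), degree_X_pow]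
  have hs := IsAlgClosed.splits (X ^ n + ofFn n a)
  obtain ⟨l, hl⟩ := Quot.exists_rep (X ^ n + ofFn n a).roots
  have hc : l.length = n := by
    rw [← hn, hs.natDegree_eq_card_roots, ← hl]; rfl
  subst hc
  refine ⟨l.get, funext fun k => ?_⟩
  have : ∏ i, (X - C (l.get i)) = X ^ l.length + ofFn l.length a := by
    rw [hs.eq_prod_roots_of_monic hp, ← hl]
    change _ = (Multiset.map _ (l : Multiset ℂ)).prod
    rw [Multiset.map_coe, Multiset.prod_coe, ← List.prod_ofFn]
    congr 1
    exact List.ext_get (by simp) (by simp)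
  rw [monicCoeffs, this, coeff_add, coeff_X_pow, if_neg k.2.ne, zero_add,
    ofFn_coeff_eq_val_of_lt a k.2]

theorem norm_le_norm_monicCoeffs_add_one {n : ℕ} (z : Fin n → ℂ) :
    ‖z‖ ≤ ‖monicCoeffs z‖ + 1 := by
  rw [pi_norm_le_iff_of_nonneg (by positivity)]
  intro i
  have hm : (∏ i, (X - C (z i))).Monic := monic_prod_X_sub_C _ _
  have hr : (∏ i, (X - C (z i))).IsRoot (z i) := by
    rw [IsRoot.def, eval_prod]
    exact Finset.prod_eq_zero (Finset.mem_univ i) (by simp)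
  refine (NNReal.coe_le_coe.2 (hr.norm_lt_cauchyBound hm.ne_zero).le).trans ?_
  rw [cauchyBound, hm.leadingCoeff, nnnorm_one, div_one, NNReal.coe_add, NNReal.coe_one]
  gcongr
  rw [← coe_nnnorm, NNReal.coe_le_coe]
  refine Finset.sup_le fun k hk => ?_
  have hk' : k < n := by simpa using hk
  exact nnnorm_le_pi_nnnorm (monicCoeffs z) ⟨k, hk'⟩

theorem isProperMap_monicCoeffs (n : ℕ) :
    IsProperMap (monicCoeffs : (Fin n → ℂ) → Fin n → ℂ) := by
  rw [isProperMap_iff_isCompact_preimage]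
  refine ⟨continuous_monicCoeffs n, fun K hK => ?_⟩
  obtain ⟨R, hR⟩ := hK.isBounded.exists_norm_le
  refine Metric.isCompact_of_isClosed_isBounded
    (hK.isClosed.preimage (continuous_monicCoeffs n))
    (isBounded_iff_forall_norm_le.2 ⟨R + 1, fun z hz => ?_⟩)
  exact (norm_le_norm_monicCoeffs_add_one z).trans (by gcongr; exact hR _ hz)

theorem monicCoeffs_zero_ne_zero_iff {m : ℕ} {z : Fin (m + 1) → ℂ} :
    monicCoeffs z 0 ≠ 0 ↔ ∀ i, z i ≠ 0 := by
  simp [monicCoeffs, coeff_zero_eq_eval_zero, eval_prod, Finset.prod_eq_zero_iff]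

/-- The coefficients of `∏ i, (X - z i)` for a tuple `z` of nonzero complex numbers, with the
nonzero constant coefficient in the last component. -/
noncomputable def puncturedMonicCoeffs {m : ℕ} (z : Fin (m + 1) → {z : ℂ // z ≠ 0}) :
    (Fin m → ℂ) × {z : ℂ // z ≠ 0} :=
  (fun k => monicCoeffs (fun i => (z i : ℂ)) k.succ,
    ⟨monicCoeffs (fun i => (z i : ℂ)) 0, monicCoeffs_zero_ne_zero_iff.2 fun i => (z i).2⟩)

theorem puncturedMonicCoeffs_eq_iff_cons {m : ℕ} {z : Fin (m + 1) → {z : ℂ // z ≠ 0}}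
    {y : (Fin m → ℂ) × {z : ℂ // z ≠ 0}} :
    puncturedMonicCoeffs z = y ↔
      monicCoeffs (fun i => (z i : ℂ)) = Fin.cons (y.2 : ℂ) y.1 := by
  simp [puncturedMonicCoeffs, Prod.ext_iff, Subtype.ext_iff, funext_iff, Fin.forall_fin_succ,
    and_comm]

theorem continuous_puncturedMonicCoeffs (m : ℕ) :
    Continuous (puncturedMonicCoeffs (m := m)) := by
  have h : Continuous fun z : Fin (m + 1) → {z : ℂ // z ≠ 0} =>
      monicCoeffs fun i => (z i : ℂ) := (continuous_monicCoeffs _).comp (by fun_prop)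
  exact (continuous_pi fun k => (continuous_apply _).comp h).prodMk
    (((continuous_apply _).comp h).subtype_mk _)

theorem exists_lift_of_monicCoeffs_eq_cons {m : ℕ} {z : Fin (m + 1) → ℂ}
    {y : (Fin m → ℂ) × {z : ℂ // z ≠ 0}} (h : monicCoeffs z = Fin.cons (y.2 : ℂ) y.1) :
    ∃ w : Fin (m + 1) → {z : ℂ // z ≠ 0},
      (fun i => (w i : ℂ)) = z ∧ puncturedMonicCoeffs w = y := by
  have hz : ∀ i, z i ≠ 0 := by
    rw [← monicCoeffs_zero_ne_zero_iff, h]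
    exact y.2.2
  exact ⟨fun i => ⟨z i, hz i⟩, rfl, puncturedMonicCoeffs_eq_iff_cons.2 h⟩

theorem puncturedMonicCoeffs_surjective (m : ℕ) :
    Function.Surjective (puncturedMonicCoeffs (m := m)) := fun y => by
  obtain ⟨z, hz⟩ := monicCoeffs_surjective (m + 1) (Fin.cons (y.2 : ℂ) y.1)
  obtain ⟨w, -, hw⟩ := exists_lift_of_monicCoeffs_eq_cons hz
  exact ⟨w, hw⟩

theorem isClosedMap_puncturedMonicCoeffs (m : ℕ) :
    IsClosedMap (puncturedMonicCoeffs (m := m)) := by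
  intro s hs
  have hind : Topology.IsInducing fun (z : Fin (m + 1) → {z : ℂ // z ≠ 0}) i => (z i : ℂ) :=
    Topology.IsInducing.piMap fun _ => Topology.IsInducing.subtypeVal
  obtain ⟨t, ht, rfl⟩ := hind.isClosed_iff.1 hs
  have hcons : Continuous fun y : (Fin m → ℂ) × {z : ℂ // z ≠ 0} =>
      (Fin.cons (y.2 : ℂ) y.1 : Fin (m + 1) → ℂ) := by fun_prop
  convert! ((isProperMap_monicCoeffs (m + 1)).isClosedMap t ht).preimage hcons using 1
  ext y
  constructor
  · rintro ⟨z, hz, hy⟩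
    exact ⟨_, hz, puncturedMonicCoeffs_eq_iff_cons.1 hy⟩
  · rintro ⟨z, hz, hy⟩
    obtain ⟨w, rfl, hw⟩ := exists_lift_of_monicCoeffs_eq_cons hy
    exact ⟨w, hz, hw⟩

theorem permSetoid_eq_ker_puncturedMonicCoeffs (m : ℕ) :
    permSetoid (m + 1) {z : ℂ // z ≠ 0} = Setoid.ker (puncturedMonicCoeffs (m := m)) := by
  ext z w
  rw [Setoid.ker_def, puncturedMonicCoeffs_eq_iff_cons,
    ← puncturedMonicCoeffs_eq_iff_cons.1 (Eq.refl (puncturedMonicCoeffs w)), monicCoeffs_eq_iff]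
  refine exists_congr fun σ => ?_
  simp [funext_iff, Subtype.ext_iff]

end MonicCoeffs

/-- For `n ≥ 1`, the `n`-th symmetric product of the punctured complex plane
`ℂ ∖ {0}` is homeomorphic to `ℂ^{n-1} × (ℂ ∖ {0})`. -/
theorem symProd_punctured_plane_homeomorph (n : ℕ) (hn : 1 ≤ n) :
    Nonempty (SymProd n {z : ℂ // z ≠ 0} ≃ₜ (Fin (n - 1) → ℂ) × {z : ℂ // z ≠ 0}) := by
  obtain ⟨m, rfl⟩ := Nat.exists_eq_add_of_le' hn
  change Nonempty (Quotient (permSetoid (m + 1) {z : ℂ // z ≠ 0}) ≃ₜ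
    (Fin m → ℂ) × {z : ℂ // z ≠ 0})
  rw [permSetoid_eq_ker_puncturedMonicCoeffs]
  have hq := (isClosedMap_puncturedMonicCoeffs m).isQuotientMap
    (continuous_puncturedMonicCoeffs m) (puncturedMonicCoeffs_surjective m)
  exact ⟨Topology.IsQuotientMap.homeomorph
    (f := ⟨puncturedMonicCoeffs, continuous_puncturedMonicCoeffs m⟩) hq⟩
end

section
/- Let k ≥ 1 and let W_k denote the wedge of k circles, i.e. the quotient of (Fin k) × S^1 obtained by collapsing the set (Fin k) × {1} to a single point. For every n with n ≥ k, the map φ : Sym^n(W_k) → (S^1)^k, which sends the class of an n-tuple of points of W_k to the k-tuple whose i-th coordinate is the product (in the circle group) of the circle coordinates of those points of the tuple lying on the i-th circle (points equal to the wedge point contributing 1), is a homotopy equivalence. In particular Sym^n(W_k) is homotopy equivalent to the k-torus (S^1)^k whenever n ≥ k ≥ 1. -/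
/-- The relation on `(Fin k) × S^1` identifying all the points `(i, 1)`. -/
def WedgeRel (k : ℕ) (p q : Fin k × Circle) : Prop :=
  p.2 = 1 ∧ q.2 = 1

/-- The wedge of `k` circles: the quotient of `(Fin k) × S^1` collapsing the
set `(Fin k) × {1}` to a single point, with the quotient topology. -/
def WedgeOfCircles (k : ℕ) : Type := Quot (WedgeRel k)

instance (k : ℕ) : TopologicalSpace (WedgeOfCircles k) :=
  inferInstanceAs (TopologicalSpace (Quot (WedgeRel k)))

/-- The `i`-th circle coordinate of a point of the wedge of `k` circles: the
circle coordinate if the point lies on the `i`-th circle, and `1` otherwise. -/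
noncomputable def circleCoord {k : ℕ} (i : Fin k) : WedgeOfCircles k → Circle :=
  Quot.lift (fun p => if p.1 = i then p.2 else 1)
    (by rintro p q ⟨hp, hq⟩; simp [hp, hq])

open Topology

namespace SymProd

variable {n : ℕ} {X : Type*}

theorem mk_surjective : Function.Surjective (mk : (Fin n → X) → SymProd n X) :=
  Quotient.mk_surjective

theorem mk_eq_mk {f g : Fin n → X} :
    mk f = mk g ↔ ∃ σ : Equiv.Perm (Fin n), f ∘ σ = g :=
  Quotient.eq

/-- Two tuples which are constant, with the same value, outside two subsets of the indices define
the same class as soon as a bijection of these subsets matches their remaining entries. -/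
theorem mk_eq_mk_of_subtype_equiv {f g : Fin n → X} {p q : Fin n → Prop} (b : X)
    (hf : ∀ j, ¬ p j → f j = b) (hg : ∀ j, ¬ q j → g j = b)
    (e : {j // p j} ≃ {j // q j}) (he : ∀ j, g (e j) = f j) : mk f = mk g := by
  classical
  refine Eq.symm (mk_eq_mk.2 ⟨e.extendSubtype, funext fun j => ?_⟩)
  by_cases hj : p j
  · simpa [Function.comp_apply, e.extendSubtype_apply_of_mem j hj] using he ⟨j, hj⟩
  · rw [Function.comp_apply, hg _ (e.extendSubtype_not_mem j hj), hf j hj]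

variable [TopologicalSpace X]

theorem continuous_mk : Continuous (mk : (Fin n → X) → SymProd n X) :=
  continuous_quot_mk

theorem isOpenQuotientMap_mk : IsOpenQuotientMap (mk : (Fin n → X) → SymProd n X) where
  surjective := mk_surjective
  continuous := continuous_mk
  isOpenMap U hU := by
    have h : mk ⁻¹' (mk '' U) =
        ⋃ σ : Equiv.Perm (Fin n), (fun f : Fin n → X => f ∘ σ) ⁻¹' U := by
      ext f
      simp only [Set.mem_preimage, Set.mem_image, mk_eq_mk, Set.mem_iUnion]
      constructor
      · rintro ⟨g, hg, σ, rfl⟩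
        exact ⟨σ.symm, by simpa [Function.comp_assoc] using hg⟩
      · rintro ⟨σ, hσ⟩
        exact ⟨_, hσ, σ.symm, by simp [Function.comp_assoc]⟩
    have hq : IsQuotientMap (mk : (Fin n → X) → SymProd n X) := isQuotientMap_quot_mk
    rw [← hq.isOpen_preimage, h]
    exact isOpen_iUnion fun σ => hU.preimage (by fun_prop)

instance [T2Space X] : T2Space (SymProd n X) := by
  rw [t2Space_iff_of_isOpenQuotientMap isOpenQuotientMap_mk]
  have h : {q : (Fin n → X) × (Fin n → X) | mk q.1 = mk q.2} =
      ⋃ σ : Equiv.Perm (Fin n), {q | q.1 ∘ σ = q.2} := by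
    ext q
    simp [mk_eq_mk]
  rw [h]
  exact isClosed_iUnion_of_finite fun σ => isClosed_eq (by fun_prop) (by fun_prop)

end SymProd

/-- The point of the circle at angle `2 * π * x`. -/
noncomputable def circleAt (x : ℝ) : Circle := Circle.exp (2 * Real.pi * x)

@[fun_prop]
theorem continuous_circleAt : Continuous circleAt := by
  unfold circleAt
  fun_prop

theorem circleAt_eq_circleAt {x y : ℝ} : circleAt x = circleAt y ↔ ∃ m : ℤ, x = y + m := by
  have h : (2 * Real.pi) ≠ 0 := by positivity
  rw [circleAt, circleAt, Circle.exp_eq_exp]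
  refine exists_congr fun m => ?_
  rw [← mul_right_inj' h (b := x), mul_add, mul_comm (m : ℝ)]

@[simp]
theorem circleAt_zero : circleAt 0 = 1 := by simp [circleAt]

theorem circleAt_sum {ι : Type*} (s : Finset ι) (x : ι → ℝ) :
    circleAt (∑ j ∈ s, x j) = ∏ j ∈ s, circleAt (x j) := by
  classical
  induction s using Finset.induction_on with
  | empty => simp
  | insert a s ha ih =>
    rw [Finset.sum_insert ha, Finset.prod_insert ha, ← ih, circleAt, mul_add, Circle.exp_add]
    rfl

theorem exists_circleAt_eq (z : Circle) : ∃ x : unitInterval, circleAt x = z := by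
  have h : (2 * Real.pi) ≠ 0 := by positivity
  obtain ⟨y, rfl⟩ := Circle.exp_surjective z
  refine ⟨⟨Int.fract (y / (2 * Real.pi)), Int.fract_nonneg _, (Int.fract_lt_one _).le⟩, ?_⟩
  have hy : Circle.exp y = circleAt (y / (2 * Real.pi)) := by
    rw [circleAt, mul_div_cancel₀ _ h]
  rw [hy, circleAt_eq_circleAt]
  exact ⟨-⌊y / (2 * Real.pi)⌋, by simp [Int.fract, sub_eq_add_neg]⟩

theorem circleAt_eq_one_iff (x : unitInterval) : circleAt x = 1 ↔ x = 0 ∨ x = 1 := by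
  rw [← circleAt_zero, circleAt_eq_circleAt]
  constructor
  · rintro ⟨m, hm⟩
    have h0 := x.2.1
    have h1 := x.2.2
    rw [hm, zero_add] at h0 h1
    have h2 : 0 ≤ m := by exact_mod_cast h0
    have h3 : m ≤ 1 := by exact_mod_cast h1
    obtain rfl | rfl : m = 0 ∨ m = 1 := by lia
    · exact Or.inl (Subtype.ext (by simpa using hm))
    · exact Or.inr (Subtype.ext (by simpa using hm))
  · rintro (rfl | rfl)
    · exact ⟨0, by simp⟩
    · exact ⟨1, by simp⟩

theorem eq_of_circleAt_eq {x y : unitInterval} (hx : ¬ (x = 0 ∨ x = 1))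
    (h : circleAt x = circleAt y) : x = y := by
  obtain ⟨m, hm⟩ := circleAt_eq_circleAt.1 h
  push Not at hx
  have h0 : (0 : ℝ) < x := unitInterval.pos_iff_ne_zero.2 hx.1
  have h1 : (x : ℝ) < 1 := unitInterval.lt_one_iff_ne_one.2 hx.2
  have h2 : (-1 : ℝ) < m := by linarith [y.2.2]
  have h3 : (m : ℝ) < 1 := by linarith [y.2.1]
  have h4 : -1 < m := by exact_mod_cast h2
  have h5 : m < 1 := by exact_mod_cast h3
  obtain rfl : m = 0 := by lia
  exact Subtype.ext (by simpa using hm)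

namespace WedgeOfCircles

variable {k : ℕ}

/-- The inclusion of the `i`-th circle in the wedge. -/
def inc (i : Fin k) (z : Circle) : WedgeOfCircles k :=
  Quot.mk _ (i, z)

theorem continuous_inc (i : Fin k) : Continuous (inc i) :=
  continuous_quot_mk.comp (by fun_prop)

theorem inc_one_eq_inc_one (i j : Fin k) : inc i 1 = inc j 1 :=
  Quot.sound ⟨rfl, rfl⟩

theorem circleCoord_inc (i j : Fin k) (z : Circle) :
    circleCoord i (inc j z) = if j = i then z else 1 :=
  rfl

/-- The point of the wedge at position `p.2` on the `p.1`-th circle, each circle being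
parametrized by the unit interval. -/
noncomputable def pt (p : Fin k × unitInterval) : WedgeOfCircles k :=
  inc p.1 (circleAt p.2)

theorem continuous_pt : Continuous (pt : Fin k × unitInterval → WedgeOfCircles k) :=
  continuous_quot_mk.comp (by fun_prop)

theorem pt_surjective : Function.Surjective (pt : Fin k × unitInterval → WedgeOfCircles k) := by
  rintro ⟨i, z⟩
  obtain ⟨x, rfl⟩ := exists_circleAt_eq z
  exact ⟨(i, x), rfl⟩

theorem circleCoord_pt (i : Fin k) (p : Fin k × unitInterval) :
    circleCoord i (pt p) = if p.1 = i then circleAt p.2 else 1 :=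
  rfl

theorem pt_eq_inc_one {p : Fin k × unitInterval} (hp : p.2 = 0 ∨ p.2 = 1) (i : Fin k) :
    pt p = inc i 1 := by
  rw [pt, (circleAt_eq_one_iff _).2 hp]
  exact inc_one_eq_inc_one _ _

theorem eq_of_circleCoord_pt_eq {p q : Fin k × unitInterval} (hp : ¬ (p.2 = 0 ∨ p.2 = 1))
    (h : circleCoord p.1 (pt p) = circleCoord p.1 (pt q)) : p = q := by
  rw [circleCoord_pt, circleCoord_pt, if_pos rfl] at h
  split_ifs at h with hq
  · exact Prod.ext hq.symm (eq_of_circleAt_eq hp h)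
  · exact absurd ((circleAt_eq_one_iff _).1 h) hp

theorem eq_of_pt_eq {p q : Fin k × unitInterval} (hp : ¬ (p.2 = 0 ∨ p.2 = 1))
    (h : pt p = pt q) : p = q :=
  eq_of_circleCoord_pt_eq hp (by rw [h])

theorem continuous_circleCoord (i : Fin k) : Continuous (circleCoord i) := by
  refine continuous_quot_lift _ (continuous_prod_of_discrete_left.2 fun j => ?_)
  by_cases h : j = i <;> simp only [h, if_true, if_false] <;> fun_prop

theorem circleCoord_injective :
    Function.Injective (fun (w : WedgeOfCircles k) (i : Fin k) => circleCoord i w) := by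
  intro v w h
  obtain ⟨p, rfl⟩ := pt_surjective v
  obtain ⟨q, rfl⟩ := pt_surjective w
  by_cases hp : p.2 = 0 ∨ p.2 = 1
  · by_cases hq : q.2 = 0 ∨ q.2 = 1
    · rw [pt_eq_inc_one hp p.1, pt_eq_inc_one hq p.1]
    · rw [eq_of_circleCoord_pt_eq hq (congrFun h q.1).symm]
  · rw [eq_of_circleCoord_pt_eq hp (congrFun h p.1)]

instance : T2Space (WedgeOfCircles k) :=
  .of_injective_continuous circleCoord_injective (continuous_pi continuous_circleCoord)

end WedgeOfCircles

namespace WedgeOfCircles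

variable {k n : ℕ}

/-- The product map from the symmetric product of the wedge of circles to the torus. -/
noncomputable def toTorus (k n : ℕ) : C(SymProd n (WedgeOfCircles k), Fin k → Circle) where
  toFun := Quotient.lift (fun f i => ∏ j, circleCoord i (f j)) (by
    rintro f _ ⟨σ, rfl⟩
    exact funext fun i => (Equiv.prod_comp σ fun j => circleCoord i (f j)).symm)
  continuous_toFun := continuous_quot_lift _ <| continuous_pi fun i =>
    continuous_finsetProd _ fun j _ => (continuous_circleCoord i).comp (continuous_apply j)

theorem toTorus_mk (f : Fin n → WedgeOfCircles k) (i : Fin k) :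
    toTorus k n (SymProd.mk f) i = ∏ j, circleCoord i (f j) :=
  rfl

/-- The tuple having the `j`-th coordinate of a point of the torus on the `j`-th circle for
`j < k`, and the wedge point in the remaining places. -/
noncomputable def torusTuple (hk : 1 ≤ k) (n : ℕ) (z : Fin k → Circle) (j : Fin n) :
    WedgeOfCircles k :=
  if h : (j : ℕ) < k then inc ⟨j, h⟩ (z ⟨j, h⟩) else inc ⟨0, hk⟩ 1

/-- The homotopy inverse of `WedgeOfCircles.toTorus`. -/
noncomputable def ofTorus (hk : 1 ≤ k) (n : ℕ) :
    C(Fin k → Circle, SymProd n (WedgeOfCircles k)) where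
  toFun z := SymProd.mk (torusTuple hk n z)
  continuous_toFun := SymProd.continuous_mk.comp <| continuous_pi fun j => by
    unfold torusTuple
    split_ifs with h
    · exact (continuous_inc _).comp (continuous_apply _)
    · exact continuous_const

theorem toTorus_ofTorus (hk : 1 ≤ k) (hn : k ≤ n) (z : Fin k → Circle) :
    toTorus k n (ofTorus hk n z) = z := by
  ext1 i
  refine (toTorus_mk _ i).trans ?_
  rw [Finset.prod_eq_single (Fin.castLE hn i)]
  · simp [torusTuple, circleCoord_inc]
  · intro j _ hj
    unfold torusTuple
    split_ifs with h
    · refine if_neg fun h' => hj ?_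
      rw [← h']
      rfl
    · exact ite_self _
  · simp

/-- The tuples of points of the circles of the wedge that are sorted by circle and then by
position. -/
abbrev SortedTuple (k n : ℕ) : Type :=
  {d : Fin n → Fin k × unitInterval // Monotone (toLex ∘ d)}

theorem SortedTuple.le (d : SortedTuple k n) {j l : Fin n} (h : j ≤ l)
    (hc : (d.1 j).1 = (d.1 l).1) : (d.1 j).2 ≤ (d.1 l).2 := by
  have := Prod.Lex.le_iff.1 (d.2 h)
  simp only [Function.comp_apply, ofLex_toLex, hc, lt_self_iff_false, false_or, true_and] at this
  exact this

theorem isClosed_setOf_monotone_toLex :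
    IsClosed {d : Fin n → Fin k × unitInterval | Monotone (toLex ∘ d)} := by
  simp only [Monotone, Set.ofPred_forall, Function.comp_apply, Prod.Lex.le_iff, ofLex_toLex]
  refine isClosed_iInter fun j => isClosed_iInter fun l => isClosed_iInter fun _ => ?_
  have hlt : IsClosed {d : Fin n → Fin k × unitInterval | (d j).1 < (d l).1} :=
    (isClosed_discrete {p : Fin k × Fin k | p.1 < p.2}).preimage
      (f := fun d : Fin n → Fin k × unitInterval => ((d j).1, (d l).1)) (by fun_prop)
  exact hlt.union ((isClosed_eq (by fun_prop) (by fun_prop)).inter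
    (isClosed_le (by fun_prop) (by fun_prop)))

instance : CompactSpace (SortedTuple k n) :=
  isCompact_iff_compactSpace.1 isClosed_setOf_monotone_toLex.isCompact

/-- The point of the symmetric product given by a sorted tuple. -/
noncomputable def SortedTuple.toSymProd (d : SortedTuple k n) : SymProd n (WedgeOfCircles k) :=
  SymProd.mk (pt ∘ d.1)

theorem SortedTuple.continuous_toSymProd :
    Continuous (SortedTuple.toSymProd : SortedTuple k n → _) :=
  SymProd.continuous_mk.comp <| continuous_pi fun j =>
    continuous_pt.comp ((continuous_apply j).comp continuous_subtype_val)

theorem SortedTuple.toSymProd_surjective :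
    Function.Surjective (SortedTuple.toSymProd : SortedTuple k n → _) := by
  intro s
  obtain ⟨f, rfl⟩ := SymProd.mk_surjective s
  choose d hd using fun j => pt_surjective (f j)
  refine ⟨⟨d ∘ Tuple.sort (toLex ∘ d), Tuple.monotone_sort (toLex ∘ d)⟩, ?_⟩
  refine (SymProd.mk_eq_mk.2 ⟨Tuple.sort (toLex ∘ d), ?_⟩).symm
  ext1 j
  simp [hd]

/-- The points of a sorted tuple which differ from the wedge point. -/
noncomputable def SortedTuple.support (d : SortedTuple k n) : Finset (Fin n) := by
  classical exact {j | ¬ ((d.1 j).2 = 0 ∨ (d.1 j).2 = 1)}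

theorem SortedTuple.mem_support {d : SortedTuple k n} {j : Fin n} :
    j ∈ d.support ↔ ¬ ((d.1 j).2 = 0 ∨ (d.1 j).2 = 1) := by
  simp [support]

/-- Sorted tuples with the same class have the same sequence of points other than the wedge
point. -/
theorem SortedTuple.exists_orderIso_of_toSymProd_eq {d d' : SortedTuple k n}
    (h : d.toSymProd = d'.toSymProd) :
    ∃ e : d.support ≃o d'.support, ∀ j : d.support, d'.1 (e j) = d.1 j := by
  obtain ⟨σ, hσ⟩ := SymProd.mk_eq_mk.1 h.symm
  have hpt (j : Fin n) : pt (d'.1 (σ j)) = pt (d.1 j) := congrFun hσ j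
  have hmem (j : Fin n) : j ∈ d.support ↔ σ j ∈ d'.support := by
    rw [mem_support, mem_support]
    constructor <;> intro hj
    · rwa [← eq_of_pt_eq hj (hpt j).symm]
    · rwa [← eq_of_pt_eq hj (hpt j)]
  let τ : d.support ≃ d'.support := σ.subtypeEquiv hmem
  have hτ (j : d.support) : d'.1 (τ j) = d.1 j :=
    (eq_of_pt_eq (mem_support.1 j.2) (hpt j).symm).symm
  let a : Fin d'.support.card ≃o d.support :=
    d.support.orderIsoOfFin (by simpa using Fintype.card_congr τ)
  let a' : Fin d'.support.card ≃o d'.support := d'.support.orderIsoOfFin rfl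
  have hmono : Monotone ((fun r => toLex (d'.1 (a' r))) ∘ (Equiv.refl _)) :=
    fun r s hrs => d'.2 (a'.monotone hrs)
  have hmono' : Monotone ((fun r => toLex (d'.1 (a' r))) ∘
      (a.toEquiv.trans (τ.trans a'.symm.toEquiv))) := by
    intro r s hrs
    simpa [hτ] using d.2 (a.monotone hrs)
  refine ⟨a.symm.trans a', fun j => ?_⟩
  have := congrFun (Tuple.unique_monotone hmono hmono') (a.symm j)
  simpa [hτ] using this

/-- The displacement of the `j`-th point of a sorted tuple: every point `x` of the same circle
contributes `x` if it comes before, and `x - 1` if it comes after. -/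
noncomputable def SortedTuple.shift (d : SortedTuple k n) (j : Fin n) : ℝ :=
  ∑ l, (if (d.1 l).1 = (d.1 j).1 then 1 else 0) *
    (if l < j then ((d.1 l).2 : ℝ) else if j < l then (d.1 l).2 - 1 else 0)

/-- The tuple with points moved by `t` times their displacement, stopping at the ends of the
intervals. -/
noncomputable def SortedTuple.move (t : unitInterval) (d : SortedTuple k n) (j : Fin n) :
    Fin k × unitInterval :=
  ((d.1 j).1, Set.projIcc 0 1 zero_le_one ((d.1 j).2 + t * d.shift j))

theorem SortedTuple.continuous_coe (j : Fin n) :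
    Continuous (fun d : SortedTuple k n => d.1 j) :=
  (continuous_apply j).comp continuous_subtype_val

theorem SortedTuple.continuous_shift (j : Fin n) :
    Continuous (fun d : SortedTuple k n => d.shift j) := by
  unfold shift
  refine continuous_finsetSum _ fun l _ => .mul ?_ ?_
  · exact (continuous_of_discreteTopology
      (f := fun p : Fin k × Fin k => if p.1 = p.2 then (1 : ℝ) else 0)).comp
      ((continuous_coe l).fst.prodMk (continuous_coe j).fst)
  · have := (continuous_coe (k := k) l).snd
    split_ifs <;> fun_prop

theorem SortedTuple.continuous_move :
    Continuous (fun p : unitInterval × SortedTuple k n => p.2.move p.1) := by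
  refine continuous_pi fun j => ?_
  have hj := (continuous_coe (k := k) j).comp (continuous_snd (X := unitInterval))
  have hs := (continuous_shift (k := k) j).comp (continuous_snd (X := unitInterval))
  exact hj.fst.prodMk <| continuous_projIcc.comp <|
    (continuous_subtype_val.comp hj.snd).add ((continuous_subtype_val.comp continuous_fst).mul hs)

theorem SortedTuple.move_zero (d : SortedTuple k n) : d.move 0 = d.1 := by
  ext1 j
  simp [move]

theorem SortedTuple.move_end (t : unitInterval) (d : SortedTuple k n) {j : Fin n}
    (hj : j ∉ d.support) : (d.move t j).2 = 0 ∨ (d.move t j).2 = 1 := by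
  rw [mem_support, not_not] at hj
  have ht := t.2.1
  rcases hj with hj | hj
  · left
    refine Set.projIcc_of_le_left zero_le_one ?_
    have : d.shift j ≤ 0 := Finset.sum_nonpos fun l _ => by
      split_ifs with hc hl
      · have := d.le hl.le hc
        rw [hj, ← Subtype.coe_le_coe] at this
        rwa [one_mul]
      · simpa using (d.1 l).2.2.2
      all_goals simp
    rw [hj]
    simpa using mul_nonpos_of_nonneg_of_nonpos ht this
  · right
    refine Set.projIcc_of_right_le zero_le_one ?_
    have : 0 ≤ d.shift j := Finset.sum_nonneg fun l _ => by
      split_ifs with hc hl hl'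
      · simpa using (d.1 l).2.2.1
      · have := d.le hl'.le hc.symm
        rw [hj, ← Subtype.coe_le_coe] at this
        rwa [one_mul, sub_nonneg]
      all_goals simp
    rw [hj]
    simpa using mul_nonneg ht this

theorem SortedTuple.shift_eq_sum_support (d : SortedTuple k n) {j : Fin n}
    (hj : j ∈ d.support) :
    d.shift j = ∑ l : d.support, (if (d.1 l).1 = (d.1 j).1 then 1 else 0) *
      (if (l : Fin n) < j then ((d.1 l).2 : ℝ) else if j < l then (d.1 l).2 - 1 else 0) := by
  rw [Finset.sum_coe_sort d.support fun l => (if (d.1 l).1 = (d.1 j).1 then 1 else 0) *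
      (if l < j then ((d.1 l).2 : ℝ) else if j < l then (d.1 l).2 - 1 else 0)]
  refine (Finset.sum_subset (Finset.subset_univ _) fun l _ hl => ?_).symm
  rw [mem_support, not_not] at hl
  rw [mem_support, not_or] at hj
  split_ifs with hc h h'
  · have := (d.le h.le hc).trans_lt (unitInterval.lt_one_iff_ne_one.2 hj.2)
    simp [hl.resolve_right this.ne]
  · have := (unitInterval.pos_iff_ne_zero.2 hj.1).trans_le (d.le h'.le hc.symm)
    simp [hl.resolve_left this.ne']
  all_goals simp

theorem SortedTuple.mk_move_eq (t : unitInterval) {d d' : SortedTuple k n}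
    (h : d.toSymProd = d'.toSymProd) :
    SymProd.mk (pt ∘ d.move t) = SymProd.mk (pt ∘ d'.move t) := by
  obtain rfl | hk := Nat.eq_zero_or_pos k
  · exact congrArg SymProd.mk (funext fun j => (d.1 j).1.elim0)
  obtain ⟨e, he⟩ := exists_orderIso_of_toSymProd_eq h
  refine SymProd.mk_eq_mk_of_subtype_equiv (p := (· ∈ d.support)) (q := (· ∈ d'.support))
    (inc ⟨0, hk⟩ 1)
    (fun j hj => pt_eq_inc_one (d.move_end t hj) _)
    (fun j hj => pt_eq_inc_one (d'.move_end t hj) _) e.toEquiv fun j => ?_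
  have hshift : d'.shift (e j) = d.shift j := by
    rw [shift_eq_sum_support d' (e j).2, shift_eq_sum_support d j.2]
    refine (Fintype.sum_equiv e.toEquiv _ _ fun l => ?_).symm
    simp only [RelIso.coe_fn_toEquiv, he, Subtype.coe_lt_coe, OrderIso.lt_iff_lt]
  simp only [Function.comp_apply, RelIso.coe_fn_toEquiv, move, he, hshift]

/-- The sum of the positions of the points of a sorted tuple on a given circle. -/
noncomputable def SortedTuple.total (d : SortedTuple k n) (i : Fin k) : ℝ :=
  ∑ l, if (d.1 l).1 = i then ((d.1 l).2 : ℝ) else 0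

theorem SortedTuple.toTorus_toSymProd (d : SortedTuple k n) (i : Fin k) :
    toTorus k n d.toSymProd i = circleAt (d.total i) := by
  rw [total, circleAt_sum]
  refine (toTorus_mk _ i).trans (Finset.prod_congr rfl fun l _ => ?_)
  rw [Function.comp_apply, circleCoord_pt, apply_ite circleAt, circleAt_zero]

/-- The points of a sorted tuple which lie on the same circle as the `j`-th one and after it. -/
def SortedTuple.after (d : SortedTuple k n) (j : Fin n) : Finset (Fin n) :=
  {l | (d.1 l).1 = (d.1 j).1 ∧ j < l}

theorem SortedTuple.add_shift (d : SortedTuple k n) (j : Fin n) :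
    (d.1 j).2 + d.shift j = d.total (d.1 j).1 - (d.after j).card := by
  have h : ((d.1 j).2 : ℝ) = ∑ l, if l = j then ((d.1 l).2 : ℝ) else 0 := by simp
  rw [h, shift, total, after, Finset.card_filter, Nat.cast_sum, ← Finset.sum_add_distrib,
    ← Finset.sum_sub_distrib]
  refine Finset.sum_congr rfl fun l _ => ?_
  rcases lt_trichotomy l j with hl | rfl | hl
  · simp [hl, hl.ne, hl.not_gt]
  · simp
  · by_cases hc : (d.1 l).1 = (d.1 j).1 <;> simp [hl, hl.ne', hl.not_gt, hc]

theorem SortedTuple.card_after_lt_of_lt (d : SortedTuple k n) {j l : Fin n}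
    (hc : (d.1 j).1 = (d.1 l).1) (h : j < l) : (d.after l).card < (d.after j).card := by
  refine Finset.card_lt_card (Finset.ssubset_iff_subset_ne.2 ⟨fun r hr => ?_, fun heq => ?_⟩)
  · simp only [after, Finset.mem_filter, Finset.mem_univ, true_and] at hr ⊢
    exact ⟨hr.1.trans hc.symm, h.trans hr.2⟩
  · have : l ∈ d.after j := by simp [after, hc, h]
    rw [← heq] at this
    simp [after] at this

theorem SortedTuple.eq_of_card_after_eq (d : SortedTuple k n) {j l : Fin n}
    (hc : (d.1 j).1 = (d.1 l).1) (h : (d.after j).card = (d.after l).card) : j = l := by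
  rcases lt_trichotomy j l with hl | hl | hl
  · exact absurd h (d.card_after_lt_of_lt hc hl).ne'
  · exact hl
  · exact absurd h (d.card_after_lt_of_lt hc.symm hl).ne

/-- On the `i`-th circle, the numbers of points following a given one take all the values from
`0` to the number of points of that circle minus one. -/
theorem SortedTuple.exists_card_after_eq (d : SortedTuple k n) (i : Fin k) {m : ℕ}
    (hm : m < (Finset.univ.filter fun j => (d.1 j).1 = i).card) :
    ∃ j, (d.1 j).1 = i ∧ (d.after j).card = m := by
  have himage : (Finset.univ.filter fun j => (d.1 j).1 = i).image (fun j => (d.after j).card) =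
      Finset.range (Finset.univ.filter fun j => (d.1 j).1 = i).card := by
    refine Finset.eq_of_subset_of_card_le (Finset.image_subset_iff.2 fun j hj => ?_) ?_
    · rw [Finset.mem_range]
      refine Finset.card_lt_card (Finset.ssubset_iff_subset_ne.2 ⟨fun r hr => ?_, fun heq => ?_⟩)
      · simp only [after, Finset.mem_filter, Finset.mem_univ, true_and] at hr hj ⊢
        exact hr.1.trans hj
      · rw [← heq] at hj
        simp [after] at hj
    · rw [Finset.card_range, Finset.card_image_of_injOn]
      intro j hj l hl h
      simp only [Finset.coe_filter, Finset.mem_univ, true_and, Set.mem_ofPred_eq] at hj hl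
      exact d.eq_of_card_after_eq (hj.trans hl.symm) h
  rw [← Finset.mem_range, ← himage] at hm
  simpa using hm

theorem SortedTuple.move_one_mem_iff (d : SortedTuple k n) (j : Fin n) :
    ¬ ((d.move 1 j).2 = 0 ∨ (d.move 1 j).2 = 1) ↔
      0 < d.total (d.1 j).1 - (d.after j).card ∧ d.total (d.1 j).1 - (d.after j).card < 1 := by
  rw [not_or, ← d.add_shift, ← ne_eq, ← ne_eq, ← unitInterval.pos_iff_ne_zero,
    ← unitInterval.lt_one_iff_ne_one, ← Subtype.coe_lt_coe, ← Subtype.coe_lt_coe, move,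
    Set.coe_projIcc]
  simp

theorem SortedTuple.circleAt_move_one (d : SortedTuple k n) {j : Fin n}
    (hj : ¬ ((d.move 1 j).2 = 0 ∨ (d.move 1 j).2 = 1)) :
    circleAt (d.move 1 j).2 = circleAt (d.total (d.1 j).1) := by
  have hj' := (d.move_one_mem_iff j).1 hj
  rw [circleAt_eq_circleAt]
  refine ⟨-(d.after j).card, ?_⟩
  rw [move, Set.Icc.coe_one, one_mul, d.add_shift,
    Set.projIcc_of_mem zero_le_one ⟨hj'.1.le, hj'.2.le⟩]
  simp [sub_eq_add_neg]

theorem SortedTuple.exists_move_one (d : SortedTuple k n) (i : Fin k)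
    (hi : circleAt (d.total i) ≠ 1) :
    ∃ j, (d.1 j).1 = i ∧ ¬ ((d.move 1 j).2 = 0 ∨ (d.move 1 j).2 = 1) := by
  have h0 : 0 ≤ d.total i := Finset.sum_nonneg fun l _ => by
    split_ifs
    · exact (d.1 l).2.2.1
    · rfl
  have h1 : d.total i ≤ (Finset.univ.filter fun j => (d.1 j).1 = i).card := by
    rw [Finset.card_filter, Nat.cast_sum]
    refine Finset.sum_le_sum fun l _ => ?_
    split_ifs
    · simpa using (d.1 l).2.2.2
    · simp
  have hne (m : ℕ) : d.total i ≠ m := by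
    intro hm
    refine hi ?_
    rw [← circleAt_zero, circleAt_eq_circleAt]
    exact ⟨m, by simpa using hm⟩
  have h2 : (⌊d.total i⌋₊ : ℝ) < d.total i :=
    lt_of_le_of_ne (Nat.floor_le h0) (hne _).symm
  obtain ⟨j, rfl, hj⟩ := d.exists_card_after_eq i (m := ⌊d.total i⌋₊)
    (by exact_mod_cast h2.trans_le h1)
  refine ⟨j, rfl, (d.move_one_mem_iff j).2 ?_⟩
  rw [hj]
  constructor <;> linarith [Nat.lt_floor_add_one (d.total (d.1 j).1)]

theorem SortedTuple.mk_move_one (hk : 1 ≤ k) (hn : k ≤ n) (d : SortedTuple k n) :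
    SymProd.mk (pt ∘ d.move 1) = ofTorus hk n (toTorus k n d.toSymProd) := by
  have htuple (i : Fin k) : torusTuple hk n (toTorus k n d.toSymProd) (Fin.castLE hn i) =
      inc i (circleAt (d.total i)) := by
    simp [torusTuple, toTorus_toSymProd]
  let p (j : Fin n) : Prop := ¬ ((d.move 1 j).2 = 0 ∨ (d.move 1 j).2 = 1)
  let q (l : Fin n) : Prop := ∃ i : Fin k, circleAt (d.total i) ≠ 1 ∧ Fin.castLE hn i = l
  let f (j : {j // p j}) : {l // q l} :=
    ⟨Fin.castLE hn (d.1 j).1, (d.1 j).1, by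
      rw [← d.circleAt_move_one j.2]
      exact fun h => j.2 ((circleAt_eq_one_iff _).1 h), rfl⟩
  have hf : Function.Bijective f := by
    constructor
    · rintro ⟨j, hj⟩ ⟨l, hl⟩ h
      have hc : (d.1 j).1 = (d.1 l).1 := Fin.castLE_injective hn (congrArg Subtype.val h)
      have hj' := (d.move_one_mem_iff j).1 hj
      have hl' := (d.move_one_mem_iff l).1 hl
      rw [hc] at hj'
      have h1 : ((d.after j).card : ℝ) < (d.after l).card + 1 := by linarith
      have h2 : ((d.after l).card : ℝ) < (d.after j).card + 1 := by linarith
      norm_cast at h1 h2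
      exact Subtype.ext (d.eq_of_card_after_eq hc (by lia))
    · rintro ⟨_, i, hi, rfl⟩
      obtain ⟨j, rfl, hj⟩ := d.exists_move_one i hi
      exact ⟨⟨j, hj⟩, rfl⟩
  refine SymProd.mk_eq_mk_of_subtype_equiv (p := p) (q := q) (inc ⟨0, hk⟩ 1)
    (fun j hj => pt_eq_inc_one (not_not.1 hj) _) (fun l hl => ?_) (Equiv.ofBijective f hf)
    fun j => ?_
  · by_cases h : (l : ℕ) < k
    · have hl' : circleAt (d.total ⟨l, h⟩) = 1 := by
        by_contra h'
        exact hl ⟨⟨l, h⟩, h', rfl⟩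
      have := htuple ⟨l, h⟩
      rw [hl'] at this
      exact this.trans (inc_one_eq_inc_one _ _)
    · simp [torusTuple, h]
  · refine (htuple _).trans ?_
    rw [← d.circleAt_move_one j.2]
    rfl

theorem isQuotientMap_id_prod_toSymProd :
    IsQuotientMap ((ContinuousMap.id unitInterval).prodMap
      ⟨SortedTuple.toSymProd (k := k) (n := n), SortedTuple.continuous_toSymProd⟩) :=
  IsQuotientMap.of_surjective_continuous
    (Function.surjective_id.prodMap SortedTuple.toSymProd_surjective) (map_continuous _)

/-- The homotopy from the identity of the symmetric product to the composite of
`WedgeOfCircles.toTorus` and `WedgeOfCircles.ofTorus`. -/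
noncomputable def homotopyIdOfTorusToTorus (hk : 1 ≤ k) (hn : k ≤ n) :
    (ContinuousMap.id (SymProd n (WedgeOfCircles k))).Homotopy
      ((ofTorus hk n).comp (toTorus k n)) :=
  have hfac : Function.FactorsThrough
      (fun p : unitInterval × SortedTuple k n => SymProd.mk (pt ∘ p.2.move p.1))
      ((ContinuousMap.id unitInterval).prodMap
        ⟨SortedTuple.toSymProd (k := k) (n := n), SortedTuple.continuous_toSymProd⟩) := by
    rintro ⟨t, d⟩ ⟨t', d'⟩ h
    obtain rfl : t = t' := congrArg Prod.fst h
    have hd : d.toSymProd = d'.toSymProd := congrArg Prod.snd h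
    exact SortedTuple.mk_move_eq t hd
  have hcont : Continuous
      (fun p : unitInterval × SortedTuple k n => SymProd.mk (pt ∘ p.2.move p.1)) :=
    SymProd.continuous_mk.comp <| continuous_pi fun j =>
      continuous_pt.comp ((continuous_apply j).comp SortedTuple.continuous_move)
  have hlift (t : unitInterval) (d : SortedTuple k n) :
      isQuotientMap_id_prod_toSymProd.lift ⟨_, hcont⟩ hfac (t, d.toSymProd) =
        SymProd.mk (pt ∘ d.move t) :=
    DFunLike.congr_fun (isQuotientMap_id_prod_toSymProd.lift_comp ⟨_, hcont⟩ hfac) (t, d)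
  { toContinuousMap := isQuotientMap_id_prod_toSymProd.lift ⟨_, hcont⟩ hfac
    map_zero_left := fun s => by
      obtain ⟨d, rfl⟩ := SortedTuple.toSymProd_surjective s
      refine (hlift 0 d).trans ?_
      rw [d.move_zero]
      rfl
    map_one_left := fun s => by
      obtain ⟨d, rfl⟩ := SortedTuple.toSymProd_surjective s
      exact (hlift 1 d).trans (d.mk_move_one hk hn) }

end WedgeOfCircles

/-- For `n ≥ k ≥ 1`, the map `φ : Sym^n(W_k) → (S^1)^k`, sending the class of
an `n`-tuple of points of the wedge of `k` circles to the `k`-tuple whose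
`i`-th coordinate is the product of the `i`-th circle coordinates of the points
of the tuple, is a homotopy equivalence; in particular `Sym^n(W_k)` is homotopy
equivalent to the `k`-torus. -/
theorem symProd_wedge_homotopyEquiv_torus (k n : ℕ) (hk : 1 ≤ k) (hn : k ≤ n) :
    ∃ h : ContinuousMap.HomotopyEquiv (SymProd n (WedgeOfCircles k)) (Fin k → Circle),
      ∀ f : Fin n → WedgeOfCircles k,
        h.toFun (SymProd.mk f) = fun i : Fin k => ∏ j, circleCoord i (f j) := by
  refine ⟨⟨WedgeOfCircles.toTorus k n, WedgeOfCircles.ofTorus hk n,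
    ⟨(WedgeOfCircles.homotopyIdOfTorusToTorus hk hn).symm⟩, ?_⟩, fun f => rfl⟩
  rw [show (WedgeOfCircles.toTorus k n).comp (WedgeOfCircles.ofTorus hk n) = .id _ from
    ContinuousMap.ext (WedgeOfCircles.toTorus_ofTorus hk hn)]
end
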